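/- For every fixed matrix R : Matrix (Fin r) (Fin n) ℝ, the function L ↦ f(L, R) is differentiable everywhere, and its gradient map L ↦ ∇_L f(L, R) (with respect to the Frobenius inner product) is Lipschitz continuous with Lipschitz constant ν + ‖R‖_F^2 (marginal strong smoothness of the objective in L, with an explicit constant). -/

import Mathlib

/-- The inequality-constrained matrix-completion objective, on the space of matrices
equipped with the Frobenius (entrywise) inner product, modelled as
`EuclideanSpace ℝ (Fin m × Fin r)` and `EuclideanSpace ℝ (Fin r × Fin n)`;
`(L * R) i j = ∑ k, L (i,k) * R (k,j)` and `‖·‖` is the Frobenius norm. -/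
noncomputable def objf (m n r : ℕ) (ν : ℝ) (l u : Matrix (Fin m) (Fin n) ℝ)
    (L : EuclideanSpace ℝ (Fin m × Fin r)) (R : EuclideanSpace ℝ (Fin r × Fin n)) : ℝ :=
  (1 / 2) * ∑ i, ∑ j, (max (l i j - ∑ k, L (i, k) * R (k, j)) 0) ^ 2
    + (1 / 2) * ∑ i, ∑ j, (max ((∑ k, L (i, k) * R (k, j)) - u i j) 0) ^ 2
    + (ν / 2) * ‖L‖ ^ 2 + (ν / 2) * ‖R‖ ^ 2

theorem sqpos_hasDerivAt (t : ℝ) :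
    HasDerivAt (fun s : ℝ => (max s 0) ^ 2) (2 * max t 0) t := by
  have h0 : HasFDerivAt (fun s : ℝ => (max s 0) ^ 2 - (max t 0) ^ 2 - 2 * max t 0 * (s - t))
      (0 : ℝ →L[ℝ] ℝ) t := by
    refine Asymptotics.IsBigO.hasFDerivAt (n := 2) ?_ (by norm_num)
    refine Asymptotics.IsBigO.of_bound 1 (Filter.Eventually.of_forall fun s => ?_)
    rw [Real.norm_eq_abs, Real.norm_eq_abs, Real.norm_eq_abs, abs_pow, abs_abs, sq_abs, one_mul,
      abs_le]
    rcases le_total s 0 with hs | hs <;> rcases le_total t 0 with ht | ht <;>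
      simp only [max_eq_left, max_eq_right, hs, ht] <;> constructor <;>
      nlinarith [sq_nonneg (s - t), sq_nonneg s, sq_nonneg t,
        mul_nonneg (sub_nonneg.2 hs) (sub_nonneg.2 ht)]
  have h1 := h0.hasDerivAt
  have h2 : HasDerivAt (fun s : ℝ => (max t 0) ^ 2 + 2 * max t 0 * (s - t)) (2 * max t 0) t := by
    simpa using (((hasDerivAt_id t).sub_const t).const_mul (2 * max t 0)).const_add ((max t 0) ^ 2)
  have h3 := h1.add h2
  have e : ((fun s : ℝ => (max s 0) ^ 2 - (max t 0) ^ 2 - 2 * max t 0 * (s - t)) +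
      fun s : ℝ => (max t 0) ^ 2 + 2 * max t 0 * (s - t)) = fun s : ℝ => (max s 0) ^ 2 := by
    funext s
    simp only [Pi.add_apply]
    ring
  rw [e] at h3
  simpa using h3

theorem resid_lip (l u s t : ℝ) (h : l ≤ u) :
    ((max (s - u) 0 - max (l - s) 0) - (max (t - u) 0 - max (l - t) 0)) ^ 2 ≤ (s - t) ^ 2 := by
  rw [sq_le_sq]
  rcases max_cases (s - u) 0 with h1 | h1 <;> rcases max_cases (l - s) 0 with h2 | h2 <;>
  rcases max_cases (t - u) 0 with h3 | h3 <;> rcases max_cases (l - t) 0 with h4 | h4 <;>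
  rw [h1.1, h2.1, h3.1, h4.1] <;> 
  rcases abs_cases (s - t) with h5 | h5 <;> rw [h5.1, abs_le] <;> constructor <;> linarith

/-- The gradient vector. -/
noncomputable def gradVec (m n r : ℕ) (ν : ℝ) (l u : Matrix (Fin m) (Fin n) ℝ)
    (L : EuclideanSpace ℝ (Fin m × Fin r)) (R : EuclideanSpace ℝ (Fin r × Fin n)) :
    EuclideanSpace ℝ (Fin m × Fin r) :=
  ν • L + WithLp.toLp 2 (fun p => ∑ j, (max ((∑ k, L (p.1, k) * R (k, j)) - u p.1 j) 0
    - max (l p.1 j - ∑ k, L (p.1, k) * R (k, j)) 0) * R (p.2, j))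

theorem objf_hasGradientAt (m n r : ℕ) (ν : ℝ) (l u : Matrix (Fin m) (Fin n) ℝ)
    (L : EuclideanSpace ℝ (Fin m × Fin r)) (R : EuclideanSpace ℝ (Fin r × Fin n)) :
    HasGradientAt (fun L' => objf m n r ν l u L' R) (gradVec m n r ν l u L R) L := by
  rw [hasGradientAt_iff_hasFDerivAt]
  have hP : ∀ i j, HasFDerivAt (fun L' : EuclideanSpace ℝ (Fin m × Fin r) =>
      ∑ k, L' (i, k) * R (k, j))
      (∑ k, R (k, j) • (EuclideanSpace.proj (i, k) : EuclideanSpace ℝ (Fin m × Fin r) →L[ℝ] ℝ))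
      L := by
    intro i j
    refine HasFDerivAt.fun_sum fun k _ => ?_
    exact ((EuclideanSpace.proj (i, k) :
      EuclideanSpace ℝ (Fin m × Fin r) →L[ℝ] ℝ).hasFDerivAt).mul_const (R (k, j))
  have hA := HasFDerivAt.fun_sum (u := Finset.univ) fun i _ =>
    HasFDerivAt.fun_sum (u := Finset.univ) fun j _ =>
      (sqpos_hasDerivAt (l i j - ∑ k, L (i, k) * R (k, j))).comp_hasFDerivAt L
        ((hP i j).const_sub (l i j))
  have hB := HasFDerivAt.fun_sum (u := Finset.univ) fun i _ =>
    HasFDerivAt.fun_sum (u := Finset.univ) fun j _ =>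
      (sqpos_hasDerivAt ((∑ k, L (i, k) * R (k, j)) - u i j)).comp_hasFDerivAt L
        ((hP i j).sub_const (u i j))
  have hN := (hasStrictFDerivAt_norm_sq L).hasFDerivAt
  have hT := (((hA.const_mul (1 / 2)).add (hB.const_mul (1 / 2))).add
    (hN.const_mul (ν / 2))).add_const ((ν / 2) * ‖R‖ ^ 2)
  refine HasFDerivAt.congr_fderiv (f := fun L' => objf m n r ν l u L' R) hT ?_
  ext x
  have e1 : inner ℝ (WithLp.toLp 2 (fun p : Fin m × Fin r =>
      ∑ j, (max ((∑ k, L (p.1, k) * R (k, j)) - u p.1 j) 0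
    - max (l p.1 j - ∑ k, L (p.1, k) * R (k, j)) 0) * R (p.2, j))) x
     = ∑ i, ∑ j, (max ((∑ k, L (i, k) * R (k, j)) - u i j) 0
    - max (l i j - ∑ k, L (i, k) * R (k, j)) 0) * ∑ k, R (k, j) * x (i, k) := by
    rw [PiLp.inner_apply, Fintype.sum_prod_type]
    refine Finset.sum_congr rfl fun i _ => ?_
    simp only [RCLike.inner_apply, conj_trivial, Finset.mul_sum]
    rw [Finset.sum_comm]
    refine Finset.sum_congr rfl fun j _ => Finset.sum_congr rfl fun k _ => ?_
    ring
  have hproj : ∀ q : Fin m × Fin r,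
      (EuclideanSpace.proj q : EuclideanSpace ℝ (Fin m × Fin r) →L[ℝ] ℝ) x = x q := fun _ => rfl
  rw [InnerProductSpace.toDual_apply_apply, gradVec, inner_add_left, e1, real_inner_smul_left]
  simp only [_root_.add_apply, _root_.smul_apply,
    _root_.sum_apply, _root_.neg_apply, smul_eq_mul,
    hproj, innerSL_apply_apply, sub_mul, Finset.sum_sub_distrib, nsmul_eq_mul,
    mul_neg, Finset.sum_neg_distrib, mul_assoc, ← Finset.mul_sum]
  push_cast
  ring

theorem gradVec_lip (m n r : ℕ) (ν : ℝ) (hν : 0 < ν) (l u : Matrix (Fin m) (Fin n) ℝ)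
    (hlu : ∀ i j, l i j ≤ u i j) (R : EuclideanSpace ℝ (Fin r × Fin n))
    (L₁ L₂ : EuclideanSpace ℝ (Fin m × Fin r)) :
    ‖gradVec m n r ν l u L₁ R - gradVec m n r ν l u L₂ R‖ ≤ (ν + ‖R‖ ^ 2) * ‖L₁ - L₂‖ := by
  rw [gradVec, gradVec, add_sub_add_comm, ← smul_sub, add_mul]
  refine (norm_add_le _ _).trans (add_le_add ?_ ?_)
  · rw [norm_smul, Real.norm_of_nonneg hν.le]
  refine le_of_sq_le_sq ?_ (by positivity)
  set δ : Fin m → Fin n → ℝ := fun i j =>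
    (max ((∑ k, L₁ (i, k) * R (k, j)) - u i j) 0 - max (l i j - ∑ k, L₁ (i, k) * R (k, j)) 0)
    - (max ((∑ k, L₂ (i, k) * R (k, j)) - u i j) 0 - max (l i j - ∑ k, L₂ (i, k) * R (k, j)) 0)
    with hδ
  have hR : ‖R‖ ^ 2 = ∑ k, ∑ j, R (k, j) ^ 2 := by
    rw [EuclideanSpace.real_norm_sq_eq, Fintype.sum_prod_type]
  have hD : ‖L₁ - L₂‖ ^ 2 = ∑ i, ∑ k, (L₁ (i, k) - L₂ (i, k)) ^ 2 := by
    rw [EuclideanSpace.real_norm_sq_eq, Fintype.sum_prod_type]; rfl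
  have hδ2 : ∑ i, ∑ j, δ i j ^ 2 ≤ ‖R‖ ^ 2 * ‖L₁ - L₂‖ ^ 2 := by
    rw [hR, hD, Finset.mul_sum]
    refine Finset.sum_le_sum fun i _ => ?_
    rw [Finset.sum_comm, Finset.sum_mul]
    refine Finset.sum_le_sum fun j _ => ?_
    refine (resid_lip _ _ _ _ (hlu i j)).trans ?_
    rw [← Finset.sum_sub_distrib, mul_comm]
    simp only [← sub_mul]
    exact Finset.sum_mul_sq_le_sq_mul_sq _ _ _
  calc _ = ∑ i, ∑ k, (∑ j, δ i j * R (k, j)) ^ 2 := by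
        rw [EuclideanSpace.real_norm_sq_eq, Fintype.sum_prod_type]
        simp only [PiLp.sub_apply, ← Finset.sum_sub_distrib, ← sub_mul, hδ]
    _ ≤ ∑ i, ∑ k, (∑ j, δ i j ^ 2) * ∑ j, R (k, j) ^ 2 :=
        Finset.sum_le_sum fun i _ => Finset.sum_le_sum fun k _ =>
          Finset.sum_mul_sq_le_sq_mul_sq _ _ _
    _ = (∑ i, ∑ j, δ i j ^ 2) * ‖R‖ ^ 2 := by
        simp only [hR, ← Finset.mul_sum, ← Finset.sum_mul]
    _ ≤ (‖R‖ ^ 2 * ‖L₁ - L₂‖ ^ 2) * ‖R‖ ^ 2 := by gcongr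
    _ = _ := by ring

/-- Marginal strong smoothness in `L`: for every fixed `R`, the map `L ↦ f(L, R)` is
differentiable everywhere and its gradient map (w.r.t. the Frobenius inner product) is
Lipschitz continuous with constant `ν + ‖R‖_F²`. -/
theorem marginal_smoothness (m n r : ℕ) (hm : 0 < m) (hn : 0 < n) (hr : 0 < r)
    (ν : ℝ) (hν : 0 < ν) (l u : Matrix (Fin m) (Fin n) ℝ)
    (hlu : ∀ i j, l i j ≤ u i j) :
    ∀ R : EuclideanSpace ℝ (Fin r × Fin n),
      (∀ L : EuclideanSpace ℝ (Fin m × Fin r),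
        DifferentiableAt ℝ (fun L' => objf m n r ν l u L' R) L) ∧
      (∀ L₁ L₂ : EuclideanSpace ℝ (Fin m × Fin r),
        ‖gradient (fun L' => objf m n r ν l u L' R) L₁
          - gradient (fun L' => objf m n r ν l u L' R) L₂‖
          ≤ (ν + ‖R‖ ^ 2) * ‖L₁ - L₂‖) := by
  intro R
  refine ⟨fun L => (objf_hasGradientAt m n r ν l u L R).differentiableAt, fun L₁ L₂ => ?_⟩
  rw [(objf_hasGradientAt m n r ν l u L₁ R).gradient, (objf_hasGradientAt m n r ν l u L₂ R).gradient]
  exact gradVec_lip m n r ν hν l u hlu R L₁ L₂
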